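/- (Hardy–Sobolev type inequality for the Grushin gradient.) Let p, s be real numbers with 1 < p < Q and 0 ≤ s ≤ p, and set p_*(s,p,Q) = p(Q−s)/(Q−p). Then there exists a constant C > 0, depending only on s, p, μ and Q, such that for every u ∈ C_0^∞(ℝ^{d+k}): ∫_{ℝ^{d+k}} (|x|^{μs}/ρ^{μs}) · |u|^{p_*(s,p,Q)} / ρ^s dx dy ≤ C (∫_{ℝ^{d+k}} |∇_μ u|^p dx dy)^{(Q−s)/(Q−p)}. -/

import Mathlib

open MeasureTheory Real
open scoped RealInnerProductSpace ENNReal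

/-- The anisotropic distance function `ρ(x,y) = (|x|^{2+2μ} + (1+μ)²|y|²)^{1/(2+2μ)}`. -/
noncomputable def grho (μ : ℝ) {d k : ℕ}
    (z : EuclideanSpace ℝ (Fin d) × EuclideanSpace ℝ (Fin k)) : ℝ :=
  (‖z.1‖ ^ (2 + 2 * μ) + (1 + μ) ^ 2 * ‖z.2‖ ^ 2) ^ (1 / (2 + 2 * μ))

/-- The Grushin gradient `∇_μ u = (∇_x u, |x|^μ ∇_y u)`. -/
noncomputable def gradMu (μ : ℝ) {d k : ℕ}
    (u : EuclideanSpace ℝ (Fin d) × EuclideanSpace ℝ (Fin k) → ℝ)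
    (z : EuclideanSpace ℝ (Fin d) × EuclideanSpace ℝ (Fin k)) :
    EuclideanSpace ℝ (Fin d) × EuclideanSpace ℝ (Fin k) :=
  (gradient (fun x => u (x, z.2)) z.1, (‖z.1‖ ^ μ) • gradient (fun y => u (z.1, y)) z.2)

/-- The Euclidean-type norm `((|v₁|² + |v₂|²))^{1/2}` of a pair. -/
noncomputable def pairNorm {d k : ℕ}
    (v : EuclideanSpace ℝ (Fin d) × EuclideanSpace ℝ (Fin k)) : ℝ :=
  Real.sqrt (‖v.1‖ ^ 2 + ‖v.2‖ ^ 2)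

/-- `|∇_μ u| = (|∇_x u|² + |x|^{2μ}|∇_y u|²)^{1/2}`. -/
noncomputable def gradMuNorm (μ : ℝ) {d k : ℕ}
    (u : EuclideanSpace ℝ (Fin d) × EuclideanSpace ℝ (Fin k) → ℝ)
    (z : EuclideanSpace ℝ (Fin d) × EuclideanSpace ℝ (Fin k)) : ℝ :=
  pairNorm (gradMu μ u z)

section Translation

theorem lintegral_Icc_zero_one_rpow_le {f : ℝ → ℝ≥0∞} (hf : Measurable f) {p : ℝ} (hp : 1 ≤ p) :
    (∫⁻ t in Set.Icc (0 : ℝ) 1, f t) ^ p ≤ ∫⁻ t in Set.Icc (0 : ℝ) 1, f t ^ p := by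
  have hp0 : 0 < p := by linarith
  have h := ENNReal.lintegral_mul_norm_pow_le (μ := volume.restrict (Set.Icc (0 : ℝ) 1))
    (f := fun t => f t ^ p) (g := fun _ => 1) (hf.pow_const p).aemeasurable aemeasurable_const
    (p := 1 / p) (q := 1 - 1 / p) (by positivity)
    (by rw [sub_nonneg, div_le_one hp0]; exact hp) (by ring)
  simp only [← ENNReal.rpow_mul, mul_one_div_cancel hp0.ne', ENNReal.rpow_one, ENNReal.one_rpow,
    mul_one, lintegral_one, Measure.restrict_apply_univ, Real.volume_Icc, sub_zero,
    ENNReal.ofReal_one] at h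
  calc _ ≤ _ := ENNReal.rpow_le_rpow h hp0.le
    _ = _ := by rw [← ENNReal.rpow_mul, one_div_mul_cancel hp0.ne', ENNReal.rpow_one]

theorem enorm_sub_le_lintegral_fderiv_segment {G : Type*} [NormedAddCommGroup G]
    [NormedSpace ℝ G] {v : G → ℝ} (hv : ContDiff ℝ 1 v) (z w : G) :
    ‖v (z + w) - v z‖ₑ ≤ ∫⁻ t in Set.Icc (0 : ℝ) 1, ‖fderiv ℝ v (z + t • w) w‖ₑ := by
  have hc : ContDiff ℝ 1 (fun t : ℝ => v (z + t • w)) := by fun_prop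
  have h := enorm_sub_le_lintegral_deriv_of_contDiffOn_Icc hc.contDiffOn (zero_le_one (α := ℝ))
  simp only [one_smul, zero_smul, add_zero] at h
  refine h.trans_eq (lintegral_congr fun t => ?_)
  have hl : HasDerivAt (fun t : ℝ => z + t • w) w t := by
    simpa using ((hasDerivAt_id t).smul_const w).const_add z
  have hd := ((hv.differentiable one_ne_zero _).hasFDerivAt).comp_hasDerivAt t hl
  exact congrArg _ hd.deriv

/-- The `L^p` size of an increment `v (z + w) - v z` over a set invariant in direction `w` is at
most that of the derivative in direction `w`. -/
theorem setLIntegral_enorm_sub_translate_rpow_le {G : Type*} [NormedAddCommGroup G]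
    [NormedSpace ℝ G] [FiniteDimensional ℝ G] [MeasurableSpace G] [BorelSpace G]
    (m : Measure G) [m.IsAddHaarMeasure]
    {v : G → ℝ} (hv : ContDiff ℝ 1 v) {p : ℝ} (hp : 1 ≤ p) (w : G) {P : Set G}
    (hP : MeasurableSet P) (hPw : ∀ z, ∀ t : ℝ, z + t • w ∈ P ↔ z ∈ P) :
    ∫⁻ z in P, ‖v (z + w) - v z‖ₑ ^ p ∂m ≤ ∫⁻ z in P, ‖fderiv ℝ v z w‖ₑ ^ p ∂m := by
  set f : G → ℝ≥0∞ := P.indicator fun z => ‖fderiv ℝ v z w‖ₑ ^ p with hf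
  have hDc : Continuous fun z => fderiv ℝ v z w :=
    (hv.continuous_fderiv one_ne_zero).clm_apply continuous_const
  have hfm : Measurable f := (hDc.enorm.measurable.pow_const p).indicator hP
  have hpt : ∀ z ∈ P, ‖v (z + w) - v z‖ₑ ^ p ≤ ∫⁻ t in Set.Icc (0 : ℝ) 1, f (z + t • w) := by
    intro z hz
    calc _ ≤ (∫⁻ t in Set.Icc (0 : ℝ) 1, ‖fderiv ℝ v (z + t • w) w‖ₑ) ^ p :=
          ENNReal.rpow_le_rpow (enorm_sub_le_lintegral_fderiv_segment hv z w) (by linarith)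
      _ ≤ ∫⁻ t in Set.Icc (0 : ℝ) 1, ‖fderiv ℝ v (z + t • w) w‖ₑ ^ p :=
          lintegral_Icc_zero_one_rpow_le
            ((hDc.comp (by fun_prop : Continuous fun t : ℝ => z + t • w)).enorm.measurable) hp
      _ = _ := lintegral_congr fun t => by
          rw [hf, Set.indicator_of_mem ((hPw z t).2 hz)]
  calc _ ≤ ∫⁻ z in P, (∫⁻ t in Set.Icc (0 : ℝ) 1, f (z + t • w)) ∂m := setLIntegral_mono' hP hpt
    _ ≤ ∫⁻ z, (∫⁻ t in Set.Icc (0 : ℝ) 1, f (z + t • w)) ∂m := setLIntegral_le_lintegral _ _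
    _ = ∫⁻ t in Set.Icc (0 : ℝ) 1, ∫⁻ z, f (z + t • w) ∂m :=
        lintegral_lintegral_swap (by
          refine (hfm.comp ?_).aemeasurable
          exact (by fun_prop : Continuous fun q : G × ℝ => q.1 + q.2 • w).measurable)
    _ = ∫⁻ t in Set.Icc (0 : ℝ) 1, ∫⁻ z, f z ∂m :=
        lintegral_congr fun t => lintegral_add_right_eq_self f _
    _ = _ := by simp [hf, lintegral_indicator hP]

end Translation

section Cutoff

theorem exists_dyadic_cutoff : ∃ φ : ℝ → ℝ, ContDiff ℝ 1 φ ∧ (∀ t, |t| ≤ 1 → φ t = 0) ∧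
    (∀ t, 2 ≤ |t| → φ t = 1) ∧
    ∃ K : ℝ, 0 ≤ K ∧ ∀ t, |deriv φ t| ≤ {t : ℝ | 1 ≤ |t| ∧ |t| < 2}.indicator (fun _ => K) t := by
  set φ : ℝ → ℝ := fun t => smoothTransition ((t ^ 2 - 1) / 3) with hφ
  have hsm : ContDiff ℝ 1 φ :=
    (smoothTransition.contDiff (n := 1)).comp
      (by fun_prop : ContDiff ℝ 1 fun t : ℝ => (t ^ 2 - 1) / 3)
  have h0 : ∀ t, |t| ≤ 1 → φ t = 0 := fun t ht =>
    smoothTransition.zero_of_nonpos (by nlinarith [abs_nonneg t, sq_abs t])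
  have h1 : ∀ t, 2 ≤ |t| → φ t = 1 := fun t ht =>
    smoothTransition.one_of_one_le (by nlinarith [abs_nonneg t, sq_abs t])
  obtain ⟨K, hK⟩ := (isCompact_Icc (a := (-2 : ℝ)) (b := 2)).exists_bound_of_continuousOn
    (hsm.continuous_deriv le_rfl).continuousOn
  refine ⟨φ, hsm, h0, h1, K, (norm_nonneg _).trans (hK 0 (by norm_num)), fun t => ?_⟩
  by_cases ht : 1 ≤ |t| ∧ |t| < 2
  · rw [Set.indicator_of_mem (by exact ht)]
    exact hK t (abs_le.1 ht.2.le)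
  · rw [Set.indicator_of_notMem (by exact ht)]
    rcases not_and_or.1 ht with h | h
    · have : IsLocalMin φ t := Filter.Eventually.of_forall fun s => by
        rw [h0 t (by linarith)]; exact smoothTransition.nonneg _
      simp [this.deriv_eq_zero]
    · have : IsLocalMax φ t := Filter.Eventually.of_forall fun s => by
        rw [h1 t (by linarith)]; exact smoothTransition.le_one _
      simp [this.deriv_eq_zero]

end Cutoff

section Sobolev

/-- `g` dominates the Grushin gradient of `u`. -/
structure IsGrushinBound {E F : Type*} [NormedAddCommGroup E] [NormedSpace ℝ E]
    [NormedAddCommGroup F] [NormedSpace ℝ F] (μ : ℝ) (u : E × F → ℝ) (g : E × F → ℝ≥0∞) :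
    Prop where
  fst : ∀ z a, ‖fderiv ℝ u z (a, 0)‖ₑ ≤ ‖a‖ₑ * g z
  snd : ∀ z b, ‖z.1‖ₑ ^ μ * ‖fderiv ℝ u z (0, b)‖ₑ ≤ ‖b‖ₑ * g z

theorem IsGrushinBound.comp_cutoff {E F : Type*} [NormedAddCommGroup E] [NormedSpace ℝ E]
    [NormedAddCommGroup F] [NormedSpace ℝ F] {μ h K : ℝ} (hh : 0 < h) {u : E × F → ℝ}
    {g : E × F → ℝ≥0∞} (hg : IsGrushinBound μ u g) (hu : ContDiff ℝ 1 u) {φ : ℝ → ℝ}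
    (hφ : ContDiff ℝ 1 φ)
    (hK : ∀ t, |deriv φ t| ≤ {t : ℝ | 1 ≤ |t| ∧ |t| < 2}.indicator (fun _ => K) t) :
    IsGrushinBound μ (fun z => φ (u z / h))
      ({z | h ≤ |u z| ∧ |u z| < 2 * h}.indicator fun z => ENNReal.ofReal (K / h) * g z) := by
  have hd : ∀ z w, ‖fderiv ℝ (fun z => φ (u z / h)) z w‖ₑ ≤
      {z | h ≤ |u z| ∧ |u z| < 2 * h}.indicator
        (fun z => ENNReal.ofReal (K / h) * ‖fderiv ℝ u z w‖ₑ) z := by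
    intro z w
    have h1 : HasFDerivAt (fun z => u z / h) (h⁻¹ • fderiv ℝ u z) z := by
      simpa [div_eq_inv_mul] using
        ((hu.differentiable one_ne_zero z).hasFDerivAt.const_mul h⁻¹)
    have h2 := (hφ.differentiable one_ne_zero (u z / h)).hasDerivAt.comp_hasFDerivAt z h1
    have h3 : fderiv ℝ (fun z => φ (u z / h)) z = deriv φ (u z / h) • h⁻¹ • fderiv ℝ u z :=
      h2.fderiv
    rw [h3]
    have hK' := hK (u z / h)
    by_cases hz : h ≤ |u z| ∧ |u z| < 2 * h
    · have hz' : 1 ≤ |u z / h| ∧ |u z / h| < 2 := by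
        rw [abs_div, abs_of_pos hh, le_div_iff₀ hh, div_lt_iff₀ hh, one_mul]; exact hz
      rw [Set.indicator_of_mem (by exact hz')] at hK'
      rw [Set.indicator_of_mem (by exact hz), smul_smul, _root_.smul_apply, enorm_smul]
      gcongr
      rw [← ofReal_norm, norm_mul, Real.norm_eq_abs, Real.norm_eq_abs, abs_inv, abs_of_pos hh,
        ← div_eq_mul_inv]
      gcongr
    · have hz' : ¬ (1 ≤ |u z / h| ∧ |u z / h| < 2) := by
        rw [abs_div, abs_of_pos hh, le_div_iff₀ hh, div_lt_iff₀ hh, one_mul]; exact hz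
      rw [Set.indicator_of_notMem (by exact hz')] at hK'
      simp [abs_nonpos_iff.1 hK']
  constructor
  · intro z a
    refine (hd z _).trans ?_
    by_cases hz : h ≤ |u z| ∧ |u z| < 2 * h
    · rw [Set.indicator_of_mem (by exact hz), Set.indicator_of_mem (by exact hz), mul_left_comm]
      gcongr
      exact hg.fst z a
    · rw [Set.indicator_of_notMem (by exact hz)]; exact zero_le
  · intro z b
    refine (mul_le_mul_right (hd z _) _).trans ?_
    by_cases hz : h ≤ |u z| ∧ |u z| < 2 * h
    · rw [Set.indicator_of_mem (by exact hz), Set.indicator_of_mem (by exact hz), mul_left_comm,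
        mul_left_comm _ (ENNReal.ofReal _)]
      exact mul_le_mul_right (hg.snd z b) _
    · rw [Set.indicator_of_notMem (by exact hz)]; simp

variable {E F : Type*} [NormedAddCommGroup E] [NormedSpace ℝ E] [FiniteDimensional ℝ E]
  [MeasureSpace E] [BorelSpace E] [(volume : Measure E).IsAddHaarMeasure]
  [NormedAddCommGroup F] [NormedSpace ℝ F] [FiniteDimensional ℝ F]
  [MeasureSpace F] [BorelSpace F] [(volume : Measure F).IsAddHaarMeasure]

instance : (volume : Measure (E × F)).IsAddHaarMeasure :=
  inferInstanceAs ((volume : Measure E).prod (volume : Measure F)).IsAddHaarMeasure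

theorem IsGrushinBound.lintegral_increment_le {μ p r : ℝ} (hμ : 0 ≤ μ) (hp : 1 ≤ p) (hr : 0 < r)
    {v : E × F → ℝ} {g : E × F → ℝ≥0∞} (hg : IsGrushinBound μ v g) (hv : ContDiff ℝ 1 v)
    {a : E} {b : F} (ha : ‖a‖ ≤ 2 * r) (hb : ‖b‖ ≤ r ^ (1 + μ)) :
    ∫⁻ z in {z : E × F | r ≤ ‖z.1 + a‖}, ‖v (z + (a, b)) - v z‖ₑ ^ p ≤
      2 ^ p * (ENNReal.ofReal (2 * r) ^ p * ∫⁻ z, g z ^ p) := by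
  have hp0 : 0 ≤ p := by linarith
  set P : Set (E × F) := {z | r ≤ ‖z.1‖} with hP
  set Pa : Set (E × F) := {z | r ≤ ‖z.1 + a‖} with hPa
  have hPm : MeasurableSet P := measurableSet_le measurable_const (by fun_prop)
  have hPam : MeasurableSet Pa := measurableSet_le measurable_const (by fun_prop)
  have hvc := hv.continuous
  have hfst : ∫⁻ z : E × F, ‖v (z + (a, 0)) - v z‖ₑ ^ p ≤
      ENNReal.ofReal (2 * r) ^ p * ∫⁻ z, g z ^ p := by
    have h := setLIntegral_enorm_sub_translate_rpow_le volume hv hp ((a, 0) : E × F)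
      MeasurableSet.univ (by simp)
    simp only [Measure.restrict_univ] at h
    refine h.trans ?_
    rw [← lintegral_const_mul' _ _ (by finiteness)]
    refine lintegral_mono fun z => ?_
    rw [← ENNReal.mul_rpow_of_nonneg _ _ hp0]
    refine ENNReal.rpow_le_rpow ((hg.fst z a).trans ?_) hp0
    gcongr
    rw [← ofReal_norm]
    exact ENNReal.ofReal_le_ofReal ha
  have hsnd : ∫⁻ z in P, ‖v (z + (0, b)) - v z‖ₑ ^ p ≤
      ENNReal.ofReal (2 * r) ^ p * ∫⁻ z, g z ^ p := by
    refine (setLIntegral_enorm_sub_translate_rpow_le volume hv hp ((0, b) : E × F) hPm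
      (by simp [hP])).trans ?_
    rw [← lintegral_const_mul' _ _ (by finiteness)]
    refine (setLIntegral_mono' hPm fun z hz => ?_).trans (setLIntegral_le_lintegral _ _)
    rw [← ENNReal.mul_rpow_of_nonneg _ _ hp0]
    refine ENNReal.rpow_le_rpow ?_ hp0
    have hrμ : ENNReal.ofReal r ^ μ ≠ 0 := by simp [hr, ENNReal.rpow_eq_zero_iff]
    refine (ENNReal.mul_le_mul_iff_right hrμ (by finiteness)).1 ?_
    have hzr : ENNReal.ofReal r ≤ ‖z.1‖ₑ := by
      rw [← ofReal_norm]; exact ENNReal.ofReal_le_ofReal hz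
    have hbr : ‖b‖ₑ ≤ ENNReal.ofReal r ^ μ * ENNReal.ofReal (2 * r) := by
      rw [← ofReal_norm, ENNReal.ofReal_rpow_of_pos hr,
        ← ENNReal.ofReal_mul (by positivity)]
      refine ENNReal.ofReal_le_ofReal (hb.trans ?_)
      rw [add_comm, Real.rpow_add_one hr.ne']
      gcongr
      linarith
    calc _ ≤ ‖z.1‖ₑ ^ μ * ‖fderiv ℝ v z (0, b)‖ₑ := by gcongr
      _ ≤ ‖b‖ₑ * g z := hg.snd z b
      _ ≤ _ := by rw [← mul_assoc]; gcongr
  calc ∫⁻ z in Pa, ‖v (z + (a, b)) - v z‖ₑ ^ p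
      ≤ ∫⁻ z in Pa, 2 ^ (p - 1) * (‖v (z + (a, 0) + (0, b)) - v (z + (a, 0))‖ₑ ^ p +
          ‖v (z + (a, 0)) - v z‖ₑ ^ p) := by
        refine lintegral_mono fun z => ?_
        refine le_trans (ENNReal.rpow_le_rpow ?_ hp0)
          (ENNReal.rpow_add_le_mul_rpow_add_rpow _ _ hp)
        have : z + (a, b) = z + (a, 0) + (0, b) := by ext <;> simp
        rw [this]
        refine le_trans (le_of_eq ?_) (enorm_add_le _ _)
        congr 1; ring
    _ = 2 ^ (p - 1) * ((∫⁻ z in Pa, ‖v (z + (a, 0) + (0, b)) - v (z + (a, 0))‖ₑ ^ p) +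
          ∫⁻ z in Pa, ‖v (z + (a, 0)) - v z‖ₑ ^ p) := by
        rw [lintegral_const_mul' _ _ (by finiteness), lintegral_add_right]
        exact (by fun_prop : Continuous fun z => v (z + (a, 0)) - v z).enorm.measurable.pow_const p
    _ ≤ 2 ^ (p - 1) * (ENNReal.ofReal (2 * r) ^ p * (∫⁻ z, g z ^ p) +
          ENNReal.ofReal (2 * r) ^ p * ∫⁻ z, g z ^ p) := by
        gcongr
        · refine le_trans (le_of_eq ?_) hsnd
          rw [← lintegral_indicator hPam, ← lintegral_indicator hPm,
            ← lintegral_add_right_eq_self (P.indicator _) ((a, 0) : E × F)]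
          rfl
        · exact (setLIntegral_le_lintegral _ _).trans hfst
    _ = _ := by
        rw [← two_mul, ← mul_assoc]
        congr 1
        nth_rw 2 [← ENNReal.rpow_one 2]
        rw [← ENNReal.rpow_add _ _ two_ne_zero ENNReal.ofNat_ne_top, sub_add_cancel]

/-- Balls `B(0, r) × B(0, r^{1+μ})` realize every finite positive volume, with `r` comparable to the
volume to the power `1 / Q`. -/
theorem exists_radius_volume_eq {μ Q : ℝ}
    (hQ : Q = Module.finrank ℝ E + (1 + μ) * Module.finrank ℝ F) (hQ0 : 0 < Q) {N : ℝ≥0∞}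
    (hN0 : N ≠ 0) (hN : N ≠ ∞) :
    ∃ r : ℝ, 0 < r ∧
      volume (Metric.ball (0 : E) r) * volume (Metric.ball (0 : F) (r ^ (1 + μ))) = N ∧
      ENNReal.ofReal r = (N / (volume (Metric.ball (0 : E) 1) *
        volume (Metric.ball (0 : F) 1))) ^ (1 / Q) := by
  set ω := volume (Metric.ball (0 : E) 1) * volume (Metric.ball (0 : F) 1) with hω
  have hω0 : ω ≠ 0 := mul_ne_zero (Metric.measure_ball_pos _ _ one_pos).ne'
    (Metric.measure_ball_pos _ _ one_pos).ne'
  have hωt : ω ≠ ∞ := ENNReal.mul_ne_top measure_ball_lt_top.ne measure_ball_lt_top.ne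
  have hq0 : N / ω ≠ 0 := (ENNReal.div_pos hN0 hωt).ne'
  have hqt : N / ω ≠ ∞ := ENNReal.div_ne_top hN hω0
  have hR0 : (N / ω) ^ (1 / Q) ≠ 0 := by
    simp [ENNReal.rpow_eq_zero_iff, hq0, hqt]
  have hRt : (N / ω) ^ (1 / Q) ≠ ∞ := ENNReal.rpow_ne_top_of_nonneg (by positivity) hqt
  have hr : 0 < ((N / ω) ^ (1 / Q)).toReal := ENNReal.toReal_pos hR0 hRt
  have hr' := ENNReal.ofReal_toReal hRt
  generalize ((N / ω) ^ (1 / Q)).toReal = r at hr hr'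
  refine ⟨r, hr, ?_, hr'⟩
  rw [Measure.addHaar_ball_of_pos _ _ hr,
    Measure.addHaar_ball_of_pos _ _ (by positivity : 0 < r ^ (1 + μ)),
    mul_mul_mul_comm, ← hω, ← ENNReal.ofReal_mul (by positivity), ← Real.rpow_natCast r,
    ← Real.rpow_natCast (r ^ (1 + μ)), ← Real.rpow_mul hr.le, ← Real.rpow_add hr, ← hQ,
    ← ENNReal.ofReal_rpow_of_pos hr, hr', ← ENNReal.rpow_mul, one_div_mul_cancel hQ0.ne',
    ENNReal.rpow_one, ENNReal.div_mul_cancel hω0 hωt]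

theorem volume_le_volume_admissible [Nontrivial E] {r s : ℝ} {u : E × F → ℝ} {h : ℝ}
    (hN : volume {z | h ≤ |u z|} ≠ ∞)
    (hvol : volume (Metric.ball (0 : E) r) * volume (Metric.ball (0 : F) s) =
      2 * volume {z | h ≤ |u z|}) (z : E × F) :
    volume {z | h ≤ |u z|} ≤ volume ((Metric.ball (0 : E) (2 * r) ×ˢ Metric.ball (0 : F) s) ∩
      {w | r ≤ ‖z.1 + w.1‖ ∧ |u (z + w)| < h}) := by
  set N := volume {z | h ≤ |u z|}
  set T := Metric.ball (0 : E) (2 * r) ×ˢ Metric.ball (0 : F) s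
  set A := T ∩ {w | r ≤ ‖z.1 + w.1‖ ∧ |u (z + w)| < h}
  have hT : 4 * N ≤ volume T := by
    have h2 : (2 : ℝ≥0∞) ≤ ENNReal.ofReal (2 ^ Module.finrank ℝ E) := by
      rw [← ENNReal.ofReal_ofNat]
      exact ENNReal.ofReal_le_ofReal (le_self_pow₀ one_le_two Module.finrank_pos.ne')
    calc 4 * N = 2 * (2 * N) := by rw [← mul_assoc]; norm_num
      _ ≤ ENNReal.ofReal (2 ^ Module.finrank ℝ E) * (2 * N) := by gcongr
      _ = volume T := by
        rw [← hvol, Measure.volume_eq_prod, Measure.prod_prod,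
          Measure.addHaar_ball_mul_of_pos _ _ two_pos, mul_assoc]
  have hcover : T ⊆ A ∪ (Metric.ball (-z.1) r ×ˢ Metric.ball (0 : F) s) ∪
      (fun w => z + w) ⁻¹' {z | h ≤ |u z|} := by
    intro w hw
    by_cases h1 : r ≤ ‖z.1 + w.1‖
    · by_cases h2 : |u (z + w)| < h
      · exact Or.inl (Or.inl ⟨hw, h1, h2⟩)
      · exact Or.inr (not_lt.1 h2)
    · refine Or.inl (Or.inr ⟨?_, hw.2⟩)
      rw [mem_ball_iff_norm, sub_neg_eq_add, add_comm]
      exact not_le.1 h1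
  have h3 : 4 * N ≤ volume A + 3 * N := by
    calc 4 * N ≤ _ := hT.trans (measure_mono hcover)
      _ ≤ volume A + volume (Metric.ball (-z.1) r ×ˢ Metric.ball (0 : F) s) +
          volume ((fun w => z + w) ⁻¹' {z | h ≤ |u z|}) :=
        (measure_union_le _ _).trans (by gcongr; exact measure_union_le _ _)
      _ = volume A + 2 * N + N := by
        rw [measure_preimage_add, ← hvol, Measure.volume_eq_prod, Measure.prod_prod,
          Measure.addHaar_ball_center, ← Measure.volume_eq_prod]
      _ = _ := by ring
  have h4 : 3 * N ≠ ∞ := by finiteness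
  refine (ENNReal.add_le_add_iff_right h4).1 (le_trans (le_of_eq ?_) h3)
  ring

/-- Weak-type Sobolev estimate between consecutive dyadic levels of `u`. -/
theorem exists_weak_sobolev [Nontrivial E] {μ Q p : ℝ} (hμ : 0 ≤ μ) (hp : 1 ≤ p)
    (hQ : Q = Module.finrank ℝ E + (1 + μ) * Module.finrank ℝ F) (hQ0 : 0 < Q) :
    ∃ C : ℝ≥0∞, C ≠ ∞ ∧ ∀ (u : E × F → ℝ) (g : E × F → ℝ≥0∞), ContDiff ℝ 1 u →
      HasCompactSupport u → IsGrushinBound μ u g → ∀ h : ℝ, 0 < h →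
      volume {z | 2 * h ≤ |u z|} * ENNReal.ofReal h ^ p ≤
        C * (volume {z | h ≤ |u z|} ^ (p / Q) *
          ∫⁻ z in {z | h ≤ |u z| ∧ |u z| < 2 * h}, g z ^ p) := by
  obtain ⟨φ, hφ, hφ0, hφ1, K, hK0, hK⟩ := exists_dyadic_cutoff
  have hp0 : 0 ≤ p := by linarith
  set ω := volume (Metric.ball (0 : E) 1) * volume (Metric.ball (0 : F) 1) with hω
  have hω0 : ω ≠ 0 := mul_ne_zero (Metric.measure_ball_pos _ _ one_pos).ne'
    (Metric.measure_ball_pos _ _ one_pos).ne'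
  set c := ENNReal.ofReal (2 ^ Module.finrank ℝ E)
  have h2ω : 2 / ω ≠ ∞ := ENNReal.div_ne_top ENNReal.ofNat_ne_top hω0
  refine ⟨c * 2 * 2 ^ p * ENNReal.ofReal (2 * K) ^ p * (2 / ω) ^ (p / Q), by finiteness,
    fun u g hu hsupp hg h hh => ?_⟩
  have huc := hu.continuous
  set N := volume {z | h ≤ |u z|} with hNdef
  set L := {z | h ≤ |u z| ∧ |u z| < 2 * h} with hL
  set S := {z | 2 * h ≤ |u z|} with hS
  have hLm : MeasurableSet L :=
    (measurableSet_le measurable_const huc.abs.measurable).inter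
      (measurableSet_lt huc.abs.measurable measurable_const)
  have hSm : MeasurableSet S := measurableSet_le measurable_const huc.abs.measurable
  have hN : N ≠ ∞ := by
    refine ne_top_of_le_ne_top hsupp.isCompact.measure_lt_top.ne (measure_mono fun z hz => ?_)
    refine subset_tsupport _ fun h0 => ?_
    have hz' : h ≤ |u z| := hz
    rw [h0, abs_zero] at hz'
    linarith
  rcases eq_or_ne N 0 with hN0 | hN0
  · have : volume S = 0 := measure_mono_null (fun z (hz : 2 * h ≤ |u z|) =>
      (by linarith : h ≤ |u z|)) hN0
    simp [this]
  obtain ⟨r, hr, hvol, hrN⟩ := exists_radius_volume_eq (E := E) (F := F) hQ hQ0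
    (mul_ne_zero two_ne_zero hN0) (ENNReal.mul_ne_top ENNReal.ofNat_ne_top hN)
  rw [← hω] at hrN
  set T := Metric.ball (0 : E) (2 * r) ×ˢ Metric.ball (0 : F) (r ^ (1 + μ)) with hT
  have hTm : MeasurableSet T := measurableSet_ball.prod measurableSet_ball
  have hTvol : volume T = c * (2 * N) := by
    rw [hT, Measure.volume_eq_prod, Measure.prod_prod, Measure.addHaar_ball_mul_of_pos _ _ two_pos,
      mul_assoc, hvol]
  set v : E × F → ℝ := fun z => φ (u z / h) with hv
  have hvd : ContDiff ℝ 1 v := hφ.comp (hu.div_const h)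
  have hvc := hvd.continuous
  have hgv := hg.comp_cutoff hh hu hφ hK
  set D := ∫⁻ z in L, g z ^ p with hD
  have hDv : ∫⁻ z, (L.indicator (fun z => ENNReal.ofReal (K / h) * g z) z) ^ p =
      ENNReal.ofReal (K / h) ^ p * D := by
    rw [hD, ← lintegral_const_mul' _ _ (by finiteness), ← lintegral_indicator hLm]
    refine lintegral_congr fun z => ?_
    by_cases hz : z ∈ L
    · simp only [Set.indicator_of_mem hz, ENNReal.mul_rpow_of_nonneg _ _ hp0]
    · simp only [Set.indicator_of_notMem hz, ENNReal.zero_rpow_of_pos (by linarith : 0 < p)]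
  set κ : E × F → E × F → ℝ≥0∞ := fun z w =>
    {q : (E × F) × (E × F) | r ≤ ‖q.1.1 + q.2.1‖}.indicator
      (fun q => ‖v (q.1 + q.2) - v q.1‖ₑ ^ p) (z, w) with hκ
  have hκm : Measurable (Function.uncurry κ) := by
    refine Measurable.indicator ?_ (measurableSet_le measurable_const (by fun_prop))
    exact (by fun_prop : Continuous fun q : (E × F) × (E × F) =>
      v (q.1 + q.2) - v q.1).enorm.measurable.pow_const p
  have hlow : ∀ z ∈ S, N ≤ ∫⁻ w in T, κ z w := by
    intro z hz
    refine (volume_le_volume_admissible hN hvol z).trans ?_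
    rw [← setLIntegral_one]
    refine le_trans (setLIntegral_mono' ?_ fun w hw => ?_)
      (lintegral_mono_set Set.inter_subset_left)
    · exact hTm.inter ((measurableSet_le (g := fun w : E × F => ‖z.1 + w.1‖) measurable_const
        (by fun_prop)).inter (measurableSet_lt (f := fun w : E × F => |u (z + w)|)
          (by fun_prop) measurable_const))
    · have h1 : v z = 1 := hφ1 _ (by
        rw [abs_div, abs_of_pos hh, le_div_iff₀ hh]; exact hz)
      have h2 : v (z + w) = 0 := hφ0 _ (by
        rw [abs_div, abs_of_pos hh, div_le_iff₀ hh, one_mul]; exact hw.2.2.le)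
      rw [hκ]
      simp only
      rw [Set.indicator_of_mem (by exact hw.2.1)]
      simp [h1, h2]
  have hup : ∀ w ∈ T, ∫⁻ z, κ z w ≤
      2 ^ p * (ENNReal.ofReal (2 * r) ^ p * (ENNReal.ofReal (K / h) ^ p * D)) := by
    rintro ⟨a, b⟩ ⟨ha, hb⟩
    rw [mem_ball_zero_iff] at ha hb
    rw [← hDv]
    refine le_trans (le_of_eq ?_) (hgv.lintegral_increment_le hμ hp hr hvd ha.le hb.le)
    rw [← lintegral_indicator (measurableSet_le measurable_const (by fun_prop))]
    rfl
  have hmain : N * volume S ≤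
      N * (c * 2 * (2 ^ p * (ENNReal.ofReal (2 * r) ^ p * (ENNReal.ofReal (K / h) ^ p * D)))) := by
    calc N * volume S = ∫⁻ z in S, N := by rw [setLIntegral_const]
      _ ≤ ∫⁻ z in S, (∫⁻ w in T, κ z w) := setLIntegral_mono' hSm hlow
      _ ≤ ∫⁻ z, (∫⁻ w in T, κ z w) := setLIntegral_le_lintegral _ _
      _ = ∫⁻ w in T, (∫⁻ z, κ z w) := lintegral_lintegral_swap hκm.aemeasurable
      _ ≤ ∫⁻ w in T, 2 ^ p * (ENNReal.ofReal (2 * r) ^ p * (ENNReal.ofReal (K / h) ^ p * D)) :=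
        setLIntegral_mono' hTm hup
      _ = _ := by rw [setLIntegral_const, hTvol]; ring
  have hS' := (ENNReal.mul_le_mul_iff_right hN0 hN).1 hmain
  calc volume S * ENNReal.ofReal h ^ p
      ≤ c * 2 * (2 ^ p * (ENNReal.ofReal (2 * r) ^ p * (ENNReal.ofReal (K / h) ^ p * D))) *
        ENNReal.ofReal h ^ p := by gcongr
    _ = c * 2 * 2 ^ p *
        (ENNReal.ofReal (2 * r) ^ p * ENNReal.ofReal (K / h) ^ p * ENNReal.ofReal h ^ p) * D := by
        ring
    _ = c * 2 * 2 ^ p * (ENNReal.ofReal (2 * K) ^ p * ENNReal.ofReal r ^ p) * D := by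
        simp only [← ENNReal.mul_rpow_of_nonneg _ _ hp0]
        rw [← ENNReal.ofReal_mul (by positivity), ← ENNReal.ofReal_mul (by positivity),
          ← ENNReal.ofReal_mul (by positivity)]
        congr 4
        field_simp
    _ = _ := by
        rw [hrN, ← ENNReal.rpow_mul, one_div_mul_eq_div, ENNReal.mul_div_right_comm,
          ENNReal.mul_rpow_of_nonneg _ _ (by positivity)]
        ring

theorem lintegral_enorm_rpow_le_tsum_dyadic {X : Type*} [MeasurableSpace X] {m : Measure X}
    {u : X → ℝ} (hu : Measurable u) {q : ℝ} (hq : 0 < q) :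
    ∫⁻ z, ‖u z‖ₑ ^ q ∂m ≤
      4 ^ q * ∑' j : ℤ, ENNReal.ofReal (2 ^ j) ^ q * m {z | 2 * (2 : ℝ) ^ j ≤ |u z|} := by
  have hSm : ∀ j : ℤ, MeasurableSet {z | 2 * (2 : ℝ) ^ j ≤ |u z|} := fun j =>
    measurableSet_le measurable_const (by fun_prop)
  rw [← ENNReal.tsum_mul_left]
  calc ∫⁻ z, ‖u z‖ₑ ^ q ∂m
      ≤ ∫⁻ z, ∑' j : ℤ, {z | 2 * (2 : ℝ) ^ j ≤ |u z|}.indicator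
          (fun _ => 4 ^ q * ENNReal.ofReal (2 ^ j) ^ q) z ∂m := by
        refine lintegral_mono fun z => ?_
        rcases eq_or_ne (u z) 0 with h0 | h0
        · simp [h0, ENNReal.zero_rpow_of_pos hq]
        obtain ⟨n, hn1, hn2⟩ := exists_mem_Ico_zpow (abs_pos.2 h0) (one_lt_two (α := ℝ))
        refine le_trans ?_ (ENNReal.le_tsum (n - 1))
        have h2 : (2 : ℝ) ^ n = 2 * 2 ^ (n - 1) := by
          rw [zpow_sub_one₀ two_ne_zero]; ring
        rw [Set.indicator_of_mem (by rw [Set.mem_ofPred_eq, ← h2]; exact hn1),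
          ← ENNReal.mul_rpow_of_nonneg _ _ hq.le]
        refine ENNReal.rpow_le_rpow ?_ hq.le
        rw [← ofReal_norm, Real.norm_eq_abs, ← ENNReal.ofReal_ofNat,
          ← ENNReal.ofReal_mul (by norm_num)]
        refine ENNReal.ofReal_le_ofReal ?_
        rw [zpow_add_one₀ two_ne_zero] at hn2
        linarith
    _ = ∑' j : ℤ, 4 ^ q * (ENNReal.ofReal (2 ^ j) ^ q * m {z | 2 * (2 : ℝ) ^ j ≤ |u z|}) := by
        rw [lintegral_tsum fun j => (measurable_const.indicator (hSm j)).aemeasurable]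
        refine tsum_congr fun j => ?_
        rw [lintegral_indicator_const (hSm j), mul_assoc]

theorem tsum_setLIntegral_dyadic_le {X : Type*} [MeasurableSpace X] {m : Measure X}
    {u : X → ℝ} (hu : Measurable u) (f : X → ℝ≥0∞) :
    ∑' j : ℤ, ∫⁻ z in {z | (2 : ℝ) ^ j ≤ |u z| ∧ |u z| < 2 * 2 ^ j}, f z ∂m ≤ ∫⁻ z, f z ∂m := by
  rw [← lintegral_iUnion]
  · exact setLIntegral_le_lintegral _ _
  · exact fun j => (measurableSet_le measurable_const hu.abs).inter
      (measurableSet_lt hu.abs measurable_const)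
  · have key : ∀ i j : ℤ, i < j →
        Disjoint {z | (2 : ℝ) ^ i ≤ |u z| ∧ |u z| < 2 * 2 ^ i}
          {z | (2 : ℝ) ^ j ≤ |u z| ∧ |u z| < 2 * 2 ^ j} := by
      intro i j hij
      refine Set.disjoint_left.2 fun z hz hz' => ?_
      have h1 : (2 : ℝ) ^ (i + 1) ≤ 2 ^ j := zpow_le_zpow_right₀ one_le_two hij
      rw [zpow_add_one₀ two_ne_zero] at h1
      linarith [hz.2, hz'.1]
    intro i j hij
    rcases lt_or_gt_of_ne hij with h | h
    · exact key i j h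
    · exact (key j i h).symm

theorem HasCompactSupport.lintegral_enorm_rpow_ne_top {X : Type*} [TopologicalSpace X]
    [MeasurableSpace X] {m : Measure X} [IsFiniteMeasureOnCompacts m] {u : X → ℝ}
    (hs : HasCompactSupport u) (hu : Continuous u) {q : ℝ} (hq : 0 < q) :
    ∫⁻ z, ‖u z‖ₑ ^ q ∂m ≠ ∞ := by
  obtain ⟨M, hM⟩ := hs.exists_bound_of_continuous hu
  have h : ∫⁻ z, ‖u z‖ₑ ^ q ∂m ≤ ∫⁻ z in tsupport u, ENNReal.ofReal M ^ q ∂m := by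
    rw [← setLIntegral_eq_of_support_subset (s := tsupport u)]
    · refine lintegral_mono fun z => ENNReal.rpow_le_rpow ?_ hq.le
      rw [← ofReal_norm]
      exact ENNReal.ofReal_le_ofReal (hM z)
    · intro z hz
      refine subset_tsupport _ fun h0 => hz ?_
      simp [h0, hq]
  refine ne_top_of_le_ne_top ?_ h
  rw [setLIntegral_const]
  exact ENNReal.mul_ne_top (by finiteness) hs.isCompact.measure_lt_top.ne

/-- Sobolev inequality for the Grushin gradient. -/
theorem exists_grushin_sobolev [Nontrivial E] {μ Q p : ℝ} (hμ : 0 ≤ μ) (hp : 1 ≤ p)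
    (hQ : Q = Module.finrank ℝ E + (1 + μ) * Module.finrank ℝ F) (hpQ : p < Q) :
    ∃ C : ℝ≥0∞, C ≠ ∞ ∧ ∀ (u : E × F → ℝ) (g : E × F → ℝ≥0∞), ContDiff ℝ 1 u →
      HasCompactSupport u → IsGrushinBound μ u g →
      ∫⁻ z, ‖u z‖ₑ ^ (p * Q / (Q - p)) ≤ C * (∫⁻ z, g z ^ p) ^ (Q / (Q - p)) := by
  have hp0 : 0 < p := by linarith
  have hQ0 : 0 < Q := by linarith
  have hQp : 0 < Q - p := by linarith
  obtain ⟨C, hC, hweak⟩ := exists_weak_sobolev (E := E) (F := F) hμ hp hQ hQ0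
  set q := p * Q / (Q - p) with hq
  have hq0 : 0 < q := by positivity
  refine ⟨(4 ^ q * C) ^ (Q / (Q - p)), by finiteness, fun u g hu hsupp hg => ?_⟩
  have huc := hu.continuous
  set I := ∫⁻ z, ‖u z‖ₑ ^ q with hI
  set D := ∫⁻ z, g z ^ p with hD
  have hIt : I ≠ ∞ := hsupp.lintegral_enorm_rpow_ne_top huc hq0
  have hstep : ∀ j : ℤ, ENNReal.ofReal (2 ^ j) ^ q * volume {z | 2 * (2 : ℝ) ^ j ≤ |u z|} ≤
      C * I ^ (p / Q) * ∫⁻ z in {z | (2 : ℝ) ^ j ≤ |u z| ∧ |u z| < 2 * 2 ^ j}, g z ^ p := by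
    intro j
    have h2 : (0 : ℝ) < 2 ^ j := by positivity
    have hw := hweak u g hu hsupp hg (2 ^ j) h2
    set h := ENNReal.ofReal (2 ^ j) with hh
    generalize ∫⁻ z in {z | (2 : ℝ) ^ j ≤ |u z| ∧ |u z| < 2 * 2 ^ j}, g z ^ p = Dj at hw ⊢
    have hh0 : h ≠ 0 := by simpa [hh] using h2
    have hht : h ≠ ∞ := ENNReal.ofReal_ne_top
    have hmarkov : h ^ q * volume {z | (2 : ℝ) ^ j ≤ |u z|} ≤ I := by
      refine le_trans (le_of_eq ?_) (mul_meas_ge_le_lintegral (μ := volume)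
        (f := fun z => ‖u z‖ₑ ^ q) (huc.enorm.measurable.pow_const q) (h ^ q))
      congr 3
      ext z
      rw [ENNReal.rpow_le_rpow_iff hq0, hh, ← ofReal_norm,
        ENNReal.ofReal_le_ofReal_iff (norm_nonneg _), Real.norm_eq_abs]
    have hexp : q = q * (p / Q) + p := by rw [hq]; field_simp; ring
    calc h ^ q * volume {z | 2 * (2 : ℝ) ^ j ≤ |u z|}
        = h ^ (q * (p / Q)) * (volume {z | 2 * (2 : ℝ) ^ j ≤ |u z|} * h ^ p) := by
          nth_rw 1 [hexp]
          rw [ENNReal.rpow_add _ _ hh0 hht]; ring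
      _ ≤ h ^ (q * (p / Q)) * (C * (volume {z | (2 : ℝ) ^ j ≤ |u z|} ^ (p / Q) * Dj)) :=
          mul_le_mul_right hw _
      _ = C * (h ^ q * volume {z | (2 : ℝ) ^ j ≤ |u z|}) ^ (p / Q) * Dj := by
          rw [ENNReal.mul_rpow_of_nonneg _ _ (by positivity), ← ENNReal.rpow_mul]; ring
      _ ≤ _ := by gcongr
  have hmain : I ≤ I ^ (p / Q) * (4 ^ q * C * D) := by
    calc I ≤ _ := lintegral_enorm_rpow_le_tsum_dyadic huc.measurable hq0
      _ ≤ 4 ^ q * ∑' j : ℤ, C * I ^ (p / Q) *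
            ∫⁻ z in {z | (2 : ℝ) ^ j ≤ |u z| ∧ |u z| < 2 * 2 ^ j}, g z ^ p :=
          mul_le_mul_right (ENNReal.tsum_le_tsum hstep) _
      _ ≤ 4 ^ q * (C * I ^ (p / Q) * D) := by
          rw [ENNReal.tsum_mul_left]
          gcongr
          exact tsum_setLIntegral_dyadic_le huc.measurable _
      _ = _ := by ring
  rcases eq_or_ne I 0 with hI0 | hI0
  · rw [hI0]; exact zero_le
  have hle : I ^ ((Q - p) / Q) ≤ 4 ^ q * C * D := by
    have hIp0 : I ^ (p / Q) ≠ 0 := by simp [ENNReal.rpow_eq_zero_iff, hI0, hIt]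
    refine (ENNReal.mul_le_mul_iff_right hIp0 (by finiteness)).1 (le_trans (le_of_eq ?_) hmain)
    rw [← ENNReal.rpow_add _ _ hI0 hIt, ← add_div, add_sub_cancel, div_self hQ0.ne',
      ENNReal.rpow_one]
  calc I = (I ^ ((Q - p) / Q)) ^ (Q / (Q - p)) := by
        rw [← ENNReal.rpow_mul, div_mul_div_cancel₀ hQ0.ne', div_self hQp.ne', ENNReal.rpow_one]
    _ ≤ (4 ^ q * C * D) ^ (Q / (Q - p)) := by gcongr
    _ = _ := ENNReal.mul_rpow_of_nonneg _ _ (by positivity)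

end Sobolev

section Hardy

/-- The Grushin dilation `(x, y) ↦ (t x, t^{1+μ} y)`. -/
noncomputable def grushinDilation {E F : Type*} [NormedAddCommGroup E] [NormedSpace ℝ E]
    [NormedAddCommGroup F] [NormedSpace ℝ F] (μ t : ℝ) (z : E × F) : E × F :=
  (t • z.1, t ^ (1 + μ) • z.2)

theorem lintegral_comp_grushinDilation {E F : Type*} [NormedAddCommGroup E] [NormedSpace ℝ E]
    [FiniteDimensional ℝ E] [MeasureSpace E] [BorelSpace E] [(volume : Measure E).IsAddHaarMeasure]
    [NormedAddCommGroup F] [NormedSpace ℝ F] [FiniteDimensional ℝ F]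
    [MeasureSpace F] [BorelSpace F] [(volume : Measure F).IsAddHaarMeasure]
    {μ Q t : ℝ} (hQ : Q = Module.finrank ℝ E + (1 + μ) * Module.finrank ℝ F) (ht : 0 < t)
    {f : E × F → ℝ≥0∞} (hf : Measurable f) :
    ∫⁻ z, f (grushinDilation μ t z) = ENNReal.ofReal (t ^ (-Q)) * ∫⁻ z, f z := by
  have hs : 0 < t ^ (1 + μ) := by positivity
  have hm : Measurable (Prod.map (fun x : E => t • x) (fun y : F => t ^ (1 + μ) • y)) :=
    (measurable_const_smul t).prodMap (measurable_const_smul _)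
  have hmap : (volume : Measure (E × F)).map
      (Prod.map (fun x : E => t • x) (fun y : F => t ^ (1 + μ) • y)) =
      ENNReal.ofReal (t ^ (-Q)) • volume := by
    rw [Measure.volume_eq_prod, ← Measure.map_prod_map _ _ (measurable_const_smul t)
      (measurable_const_smul _), Measure.map_addHaar_smul _ ht.ne',
      Measure.map_addHaar_smul _ hs.ne',
      Measure.prod_smul_left, Measure.prod_smul_right, smul_smul,
      ← ENNReal.ofReal_mul (abs_nonneg _), ← abs_mul, ← mul_inv, ← Real.rpow_natCast t,
      ← Real.rpow_natCast (t ^ (1 + μ)), ← Real.rpow_mul ht.le, ← Real.rpow_add ht, ← hQ,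
      abs_of_pos (by positivity), Real.rpow_neg ht.le]
  calc ∫⁻ z, f (grushinDilation μ t z) = ∫⁻ z, f z ∂((volume : Measure (E × F)).map
      (Prod.map (fun x : E => t • x) (fun y : F => t ^ (1 + μ) • y))) := (lintegral_map hf hm).symm
    _ = _ := by rw [hmap, lintegral_smul_measure, smul_eq_mul]

theorem setLIntegral_Ioi_one_rpow_ne_top {a : ℝ} (ha : a < -1) :
    ∫⁻ t in Set.Ioi (1 : ℝ), ENNReal.ofReal (t ^ a) ≠ ∞ :=
  (integrableOn_Ioi_rpow_of_lt ha one_pos).lintegral_lt_top.ne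

/-- Weighted Hölder inequality on `(1, ∞)`. -/
theorem exists_lintegral_Ioi_one_rpow_le {p β : ℝ} (hp : 1 < p) (hβ : p - 1 < β) :
    ∃ A : ℝ≥0∞, A ≠ ∞ ∧ ∀ f : ℝ → ℝ≥0∞, Measurable f →
      (∫⁻ t in Set.Ioi (1 : ℝ), f t) ^ p ≤
        A * ∫⁻ t in Set.Ioi (1 : ℝ), ENNReal.ofReal (t ^ β) * f t ^ p := by
  have hp0 : 0 < p := by linarith
  have hp1 : 0 < p - 1 := by linarith
  have hexp : -β / (p - 1) < -1 := by rw [div_lt_iff₀ hp1]; linarith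
  refine ⟨(∫⁻ t in Set.Ioi (1 : ℝ), ENNReal.ofReal (t ^ (-β / (p - 1)))) ^ (p - 1),
    ENNReal.rpow_ne_top_of_nonneg hp1.le (setLIntegral_Ioi_one_rpow_ne_top hexp),
    fun f hf => ?_⟩
  have h := ENNReal.lintegral_mul_norm_pow_le (μ := volume.restrict (Set.Ioi (1 : ℝ)))
    (f := fun t => ENNReal.ofReal (t ^ β) * f t ^ p)
    (g := fun t => ENNReal.ofReal (t ^ (-β / (p - 1))))
    (by fun_prop) (by fun_prop) (p := 1 / p) (q := 1 - 1 / p) (by positivity)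
    (by rw [sub_nonneg, div_le_one hp0]; exact hp.le) (by ring)
  have heq : ∫⁻ t in Set.Ioi (1 : ℝ), f t = ∫⁻ t in Set.Ioi (1 : ℝ),
      (ENNReal.ofReal (t ^ β) * f t ^ p) ^ (1 / p) *
        ENNReal.ofReal (t ^ (-β / (p - 1))) ^ (1 - 1 / p) := by
    refine setLIntegral_congr_fun measurableSet_Ioi fun t ht => ?_
    have ht0 : (0 : ℝ) < t := one_pos.trans ht
    rw [ENNReal.mul_rpow_of_nonneg _ _ (by positivity), ← ENNReal.rpow_mul,
      mul_one_div_cancel hp0.ne', ENNReal.rpow_one, mul_right_comm,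
      ENNReal.ofReal_rpow_of_pos (by positivity), ENNReal.ofReal_rpow_of_pos (by positivity),
      ← ENNReal.ofReal_mul (by positivity), ← Real.rpow_mul ht0.le, ← Real.rpow_mul ht0.le,
      ← Real.rpow_add ht0]
    have : β * (1 / p) + -β / (p - 1) * (1 - 1 / p) = 0 := by field_simp; ring
    rw [this, Real.rpow_zero, ENNReal.ofReal_one, one_mul]
  rw [heq]
  refine (ENNReal.rpow_le_rpow h hp0.le).trans (le_of_eq ?_)
  rw [ENNReal.mul_rpow_of_nonneg _ _ hp0.le, ← ENNReal.rpow_mul, ← ENNReal.rpow_mul,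
    one_div_mul_cancel hp0.ne', ENNReal.rpow_one, mul_comm]
  congr 2
  field_simp

variable {E F : Type*} [NormedAddCommGroup E] [NormedSpace ℝ E]
  [NormedAddCommGroup F] [NormedSpace ℝ F]

/-- Pointwise Hardy-type bound obtained by integrating `u` along the dilation orbit of `z`. -/
theorem mul_enorm_le_lintegral_grushinDilation {μ : ℝ} {u : E × F → ℝ} {g W : E × F → ℝ≥0∞}
    (hu : ContDiff ℝ 1 u) (hsupp : HasCompactSupport u)
    (hW0 : ∀ z : E × F, z.1 = 0 → W z = 0)
    (hWdil : ∀ t z, 0 < t → W z = ENNReal.ofReal t * W (grushinDilation μ t z))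
    (hWg : ∀ z, W z * ‖fderiv ℝ u z (z.1, (1 + μ) • z.2)‖ₑ ≤ g z) (hWt : ∀ z, W z ≠ ∞) (z : E × F) :
    W z * ‖u z‖ₑ ≤ ∫⁻ t in Set.Ioi (1 : ℝ), g (grushinDilation μ t z) := by
  rcases eq_or_ne z.1 0 with hz | hz
  · rw [hW0 z hz, zero_mul]; exact zero_le
  have hz' : 0 < ‖z.1‖ := norm_pos_iff.2 hz
  obtain ⟨R, hR⟩ := hsupp.isCompact.isBounded.exists_norm_le
  obtain ⟨T, hT1, hT⟩ : ∃ T : ℝ, 1 < T ∧ u (grushinDilation μ T z) = 0 := by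
    refine ⟨max 2 ((|R| + 1) / ‖z.1‖), lt_of_lt_of_le one_lt_two (le_max_left _ _), ?_⟩
    set T := max 2 ((|R| + 1) / ‖z.1‖) with hTdef
    have hT2 : (2 : ℝ) ≤ T := le_max_left _ _
    by_contra hne
    have h1 := hR _ (subset_tsupport u hne)
    have h2 : ‖T • z.1‖ ≤ ‖grushinDilation μ T z‖ := norm_fst_le (grushinDilation μ T z)
    rw [norm_smul, Real.norm_of_nonneg (by linarith)] at h2
    have h3 : (|R| + 1) ≤ T * ‖z.1‖ := by
      rw [← div_le_iff₀ hz']; exact le_max_right _ _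
    linarith [le_abs_self R]
  have hderiv : ∀ t : ℝ, 0 < t → HasDerivAt (fun t => u (grushinDilation μ t z))
      (fderiv ℝ u (grushinDilation μ t z) (z.1, ((1 + μ) * t ^ μ) • z.2)) t := by
    intro t ht
    have h1 : HasDerivAt (fun t : ℝ => t • z.1) z.1 t := by
      simpa using (hasDerivAt_id t).smul_const z.1
    have h2 : HasDerivAt (fun t : ℝ => t ^ (1 + μ) • z.2) (((1 + μ) * t ^ μ) • z.2) t := by
      simpa using (Real.hasDerivAt_rpow_const (p := 1 + μ) (Or.inl ht.ne')).smul_const z.2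
    exact (hu.differentiable one_ne_zero _).hasFDerivAt.comp_hasDerivAt t (h1.prodMk h2)
  have hcd : ContDiffOn ℝ 1 (fun t => u (grushinDilation μ t z)) (Set.Icc 1 T) := by
    refine hu.comp_contDiffOn ?_
    refine ContDiffOn.prodMk (by fun_prop) (ContDiffOn.smul ?_ contDiffOn_const)
    intro t ht
    exact (Real.contDiffAt_rpow_const_of_ne (by linarith [ht.1])).contDiffWithinAt
  have hftc := enorm_sub_le_lintegral_deriv_of_contDiffOn_Icc hcd hT1.le
  have h1 : grushinDilation μ 1 z = z := by simp [grushinDilation]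
  rw [hT, h1, zero_sub, enorm_neg] at hftc
  have hpt : ∀ t ∈ Set.Icc 1 T, W z * ‖deriv (fun t => u (grushinDilation μ t z)) t‖ₑ ≤
      g (grushinDilation μ t z) := by
    intro t ht
    have ht0 : 0 < t := by linarith [ht.1]
    refine le_trans (le_of_eq ?_) (hWg _)
    rw [(hderiv t ht0).deriv, hWdil t z ht0]
    have hvec : ((grushinDilation μ t z).1, (1 + μ) • (grushinDilation μ t z).2) =
        t • (z.1, ((1 + μ) * t ^ μ) • z.2) := by
      simp only [grushinDilation, Prod.smul_mk, smul_smul, add_comm 1 μ, Real.rpow_add_one ht0.ne']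
      congr 2; ring
    rw [hvec, map_smul, enorm_smul, Real.enorm_eq_ofReal ht0.le]
    ring
  calc W z * ‖u z‖ₑ
      ≤ W z * ∫⁻ t in Set.Icc 1 T, ‖deriv (fun t => u (grushinDilation μ t z)) t‖ₑ := by
        gcongr
    _ = ∫⁻ t in Set.Icc 1 T, W z * ‖deriv (fun t => u (grushinDilation μ t z)) t‖ₑ :=
        (lintegral_const_mul' _ _ (hWt z)).symm
    _ ≤ ∫⁻ t in Set.Icc 1 T, g (grushinDilation μ t z) := setLIntegral_mono' measurableSet_Icc hpt
    _ = ∫⁻ t in Set.Ioc 1 T, g (grushinDilation μ t z) := by rw [restrict_Ioc_eq_restrict_Icc]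
    _ ≤ _ := lintegral_mono_set Set.Ioc_subset_Ioi_self

/-- Hardy inequality for a weight homogeneous of degree `-1` under Grushin dilations. -/
theorem exists_grushin_hardy [FiniteDimensional ℝ E] [MeasureSpace E] [BorelSpace E]
    [(volume : Measure E).IsAddHaarMeasure] [FiniteDimensional ℝ F] [MeasureSpace F] [BorelSpace F]
    [(volume : Measure F).IsAddHaarMeasure] {μ Q p : ℝ} (hp : 1 < p)
    (hQ : Q = Module.finrank ℝ E + (1 + μ) * Module.finrank ℝ F) (hpQ : p < Q) :
    ∃ C : ℝ≥0∞, C ≠ ∞ ∧ ∀ (u : E × F → ℝ) (g W : E × F → ℝ≥0∞), ContDiff ℝ 1 u →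
      HasCompactSupport u → Measurable g → (∀ z : E × F, z.1 = 0 → W z = 0) →
      (∀ t z, 0 < t → W z = ENNReal.ofReal t * W (grushinDilation μ t z)) →
      (∀ z, W z * ‖fderiv ℝ u z (z.1, (1 + μ) • z.2)‖ₑ ≤ g z) → (∀ z, W z ≠ ∞) →
      ∫⁻ z, (W z * ‖u z‖ₑ) ^ p ≤ C * ∫⁻ z, g z ^ p := by
  have hp0 : 0 < p := by linarith
  set β := (p + Q) / 2 - 1 with hβ
  obtain ⟨A, hA, hAf⟩ := exists_lintegral_Ioi_one_rpow_le (β := β) hp (by rw [hβ]; linarith)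
  refine ⟨A * ∫⁻ t in Set.Ioi (1 : ℝ), ENNReal.ofReal (t ^ (β - Q)),
    ENNReal.mul_ne_top hA (setLIntegral_Ioi_one_rpow_ne_top (by rw [hβ]; linarith)),
    fun u g W hu hsupp hg hW0 hWdil hWg hWt => ?_⟩
  have hjoint : Measurable fun q : (E × F) × ℝ => grushinDilation μ q.2 q.1 :=
    (measurable_snd.smul (by fun_prop)).prodMk
      ((measurable_snd.pow_const _).smul (by fun_prop))
  calc ∫⁻ z, (W z * ‖u z‖ₑ) ^ p
      ≤ ∫⁻ z, A * ∫⁻ t in Set.Ioi (1 : ℝ),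
          ENNReal.ofReal (t ^ β) * g (grushinDilation μ t z) ^ p := by
        refine lintegral_mono fun z => ?_
        refine (ENNReal.rpow_le_rpow
          (mul_enorm_le_lintegral_grushinDilation hu hsupp hW0 hWdil hWg hWt z) hp0.le).trans ?_
        exact hAf _ (hg.comp (hjoint.comp measurable_prodMk_left))
    _ = A * ∫⁻ t in Set.Ioi (1 : ℝ), ∫⁻ z,
          ENNReal.ofReal (t ^ β) * g (grushinDilation μ t z) ^ p := by
        rw [lintegral_const_mul' _ _ hA, lintegral_lintegral_swap]
        refine Measurable.aemeasurable (Measurable.mul (by fun_prop) ?_)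
        exact (hg.comp hjoint).pow_const p
    _ = A * ∫⁻ t in Set.Ioi (1 : ℝ), ENNReal.ofReal (t ^ (β - Q)) * ∫⁻ z, g z ^ p := by
        congr 1
        refine setLIntegral_congr_fun measurableSet_Ioi fun t ht => ?_
        have ht0 : (0 : ℝ) < t := one_pos.trans ht
        rw [lintegral_const_mul' _ _ (by finiteness),
          lintegral_comp_grushinDilation hQ ht0 (f := fun z => g z ^ p) (hg.pow_const p),
          ← mul_assoc, ← ENNReal.ofReal_mul (by positivity), ← Real.rpow_add ht0, sub_eq_add_neg]
    _ = _ := by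
        rw [lintegral_mul_const _ (by fun_prop), mul_assoc]

end Hardy

section Grushin

variable {d k : ℕ} {μ : ℝ} {u : EuclideanSpace ℝ (Fin d) × EuclideanSpace ℝ (Fin k) → ℝ}

theorem gradMuNorm_eq (hu : Differentiable ℝ u)
    (z : EuclideanSpace ℝ (Fin d) × EuclideanSpace ℝ (Fin k)) :
    gradMuNorm μ u z = √(‖(fderiv ℝ u z).comp (.inl ℝ _ _)‖ ^ 2 +
      (‖z.1‖ ^ μ * ‖(fderiv ℝ u z).comp (.inr ℝ _ _)‖) ^ 2) := by
  have h1 : fderiv ℝ (fun x => u (x, z.2)) z.1 = (fderiv ℝ u z).comp (.inl ℝ _ _) :=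
    ((hu z).hasFDerivAt.comp z.1 (hasFDerivAt_prodMk_left z.1 z.2)).fderiv
  have h2 : fderiv ℝ (fun y => u (z.1, y)) z.2 = (fderiv ℝ u z).comp (.inr ℝ _ _) :=
    ((hu z).hasFDerivAt.comp z.2 (hasFDerivAt_prodMk_right z.1 z.2)).fderiv
  rw [gradMuNorm, pairNorm, gradMu, norm_smul, Real.norm_of_nonneg (by positivity), gradient,
    gradient, LinearIsometryEquiv.norm_map, LinearIsometryEquiv.norm_map, h1, h2]

theorem continuous_gradMuNorm (hμ : 0 ≤ μ) (hu : ContDiff ℝ 1 u) :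
    Continuous (gradMuNorm μ u) := by
  have h := hu.continuous_fderiv one_ne_zero
  have h1 : Continuous fun z : EuclideanSpace ℝ (Fin d) × EuclideanSpace ℝ (Fin k) =>
      ‖z.1‖ ^ μ := continuous_fst.norm.rpow_const fun _ => Or.inr hμ
  rw [funext (gradMuNorm_eq (hu.differentiable one_ne_zero))]
  fun_prop

theorem HasCompactSupport.gradMuNorm (hu : Differentiable ℝ u) (hsupp : HasCompactSupport u) :
    HasCompactSupport (gradMuNorm μ u) := by
  refine (hsupp.fderiv ℝ).mono fun z hz => ?_
  contrapose! hz
  rw [Function.notMem_support] at hz ⊢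
  simp [gradMuNorm_eq hu, hz]

theorem gradMuNorm_nonneg (z : EuclideanSpace ℝ (Fin d) × EuclideanSpace ℝ (Fin k)) :
    0 ≤ gradMuNorm μ u z := Real.sqrt_nonneg _

theorem isGrushinBound_gradMuNorm (hμ : 0 ≤ μ) (hu : Differentiable ℝ u) :
    IsGrushinBound μ u fun z => ENNReal.ofReal (gradMuNorm μ u z) where
  fst z a := by
    rw [← ofReal_norm, ← ofReal_norm, ← ENNReal.ofReal_mul (norm_nonneg _), mul_comm]
    refine ENNReal.ofReal_le_ofReal ?_
    refine (((fderiv ℝ u z).comp (.inl ℝ _ _)).le_opNorm a).trans ?_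
    rw [gradMuNorm_eq hu]
    gcongr
    exact Real.le_sqrt_of_sq_le (le_add_of_nonneg_right (sq_nonneg _))
  snd z b := by
    rw [← ofReal_norm, ← ofReal_norm, ← ofReal_norm, ENNReal.ofReal_rpow_of_nonneg
      (norm_nonneg _) hμ, ← ENNReal.ofReal_mul (by positivity),
      ← ENNReal.ofReal_mul (norm_nonneg _), mul_comm ‖b‖]
    refine ENNReal.ofReal_le_ofReal ?_
    refine (mul_le_mul_of_nonneg_left (((fderiv ℝ u z).comp (.inr ℝ _ _)).le_opNorm b)
      (by positivity)).trans ?_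
    rw [gradMuNorm_eq hu, ← mul_assoc]
    gcongr
    exact Real.le_sqrt_of_sq_le (le_add_of_nonneg_left (sq_nonneg _))

variable {z : EuclideanSpace ℝ (Fin d) × EuclideanSpace ℝ (Fin k)}

theorem grho_nonneg : 0 ≤ grho μ z := by
  unfold grho; positivity

theorem grho_rpow (hμ : 0 ≤ μ) :
    grho μ z ^ (1 + μ) = √(‖z.1‖ ^ (2 + 2 * μ) + (1 + μ) ^ 2 * ‖z.2‖ ^ 2) := by
  rw [grho, ← Real.rpow_mul (by positivity), Real.sqrt_eq_rpow]
  congr 1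
  field_simp

theorem norm_fst_rpow_le_grho (hμ : 0 ≤ μ) : ‖z.1‖ ^ (1 + μ) ≤ grho μ z ^ (1 + μ) := by
  rw [grho_rpow hμ]
  refine Real.le_sqrt_of_sq_le ?_
  rw [← Real.rpow_natCast, ← Real.rpow_mul (norm_nonneg _),
    show (1 + μ) * ((2 : ℕ) : ℝ) = 2 + 2 * μ by push_cast; ring]
  exact le_add_of_nonneg_right (by positivity)

theorem norm_snd_le_grho (hμ : 0 ≤ μ) : (1 + μ) * ‖z.2‖ ≤ grho μ z ^ (1 + μ) := by
  rw [grho_rpow hμ]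
  refine Real.le_sqrt_of_sq_le ?_
  rw [mul_pow]
  exact le_add_of_nonneg_left (by positivity)

theorem grho_grushinDilation (hμ : 0 ≤ μ) {t : ℝ} (ht : 0 < t) :
    grho μ (grushinDilation μ t z) ^ (1 + μ) = t ^ (1 + μ) * grho μ z ^ (1 + μ) := by
  rw [grho_rpow hμ, grho_rpow hμ, ← Real.sqrt_sq (show 0 ≤ t ^ (1 + μ) by positivity),
    ← Real.sqrt_mul (by positivity)]
  congr 1
  have : t ^ (2 + 2 * μ) = (t ^ (1 + μ)) ^ 2 := by
    rw [← Real.rpow_natCast, ← Real.rpow_mul ht.le]; congr 1; push_cast; ring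
  simp only [grushinDilation, norm_smul, Real.norm_of_nonneg ht.le,
    Real.norm_of_nonneg (show 0 ≤ t ^ (1 + μ) by positivity),
    Real.mul_rpow ht.le (norm_nonneg _), this]
  ring

theorem measurable_grho : Measurable (grho μ (d := d) (k := k)) := by
  unfold grho; fun_prop

theorem ofReal_norm_fst_div_grho_grushinDilation (hμ : 0 ≤ μ) {t : ℝ} (ht : 0 < t) :
    ENNReal.ofReal (‖z.1‖ ^ μ / grho μ z ^ (1 + μ)) = ENNReal.ofReal t *
      ENNReal.ofReal (‖(grushinDilation μ t z).1‖ ^ μ /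
        grho μ (grushinDilation μ t z) ^ (1 + μ)) := by
  rw [← ENNReal.ofReal_mul ht.le, grho_grushinDilation hμ ht, grushinDilation, norm_smul,
    Real.norm_of_nonneg ht.le, Real.mul_rpow ht.le (norm_nonneg _), Real.rpow_add ht,
    Real.rpow_one]
  congr 1
  have : 0 < t ^ μ := by positivity
  rcases eq_or_ne (grho μ z ^ (1 + μ)) 0 with h | h
  · simp [h]
  · field_simp

theorem IsGrushinBound.norm_fst_div_grho_mul_enorm_fderiv_le (hμ : 0 ≤ μ)
    {g : EuclideanSpace ℝ (Fin d) × EuclideanSpace ℝ (Fin k) → ℝ≥0∞} (hg : IsGrushinBound μ u g)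
    (z : EuclideanSpace ℝ (Fin d) × EuclideanSpace ℝ (Fin k)) :
    ENNReal.ofReal (‖z.1‖ ^ μ / grho μ z ^ (1 + μ)) *
      ‖fderiv ℝ u z (z.1, (1 + μ) • z.2)‖ₑ ≤ 2 * g z := by
  set R := grho μ z ^ (1 + μ) with hR
  have hR0 : 0 ≤ R := Real.rpow_nonneg grho_nonneg _
  have hsplit : fderiv ℝ u z (z.1, (1 + μ) • z.2) =
      fderiv ℝ u z (z.1, 0) + fderiv ℝ u z (0, (1 + μ) • z.2) := by
    rw [← map_add]; simp
  have hx : ENNReal.ofReal (‖z.1‖ ^ μ / R) * ‖z.1‖ₑ ≤ 1 := by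
    rw [← ofReal_norm, ← ENNReal.ofReal_mul (by positivity), ENNReal.ofReal_le_one,
      div_mul_eq_mul_div, ← Real.rpow_add_one' (norm_nonneg _) (by linarith), add_comm]
    exact div_le_one_of_le₀ (norm_fst_rpow_le_grho hμ) hR0
  have hy : ENNReal.ofReal R⁻¹ * ‖(1 + μ) • z.2‖ₑ ≤ 1 := by
    rw [← ofReal_norm, ← ENNReal.ofReal_mul (by positivity), ENNReal.ofReal_le_one, norm_smul,
      Real.norm_of_nonneg (by positivity), inv_mul_eq_div]
    exact div_le_one_of_le₀ (norm_snd_le_grho hμ) hR0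
  have hW : ENNReal.ofReal (‖z.1‖ ^ μ / R) = ENNReal.ofReal R⁻¹ * ‖z.1‖ₑ ^ μ := by
    rw [← ofReal_norm, ENNReal.ofReal_rpow_of_nonneg (norm_nonneg _) hμ,
      ← ENNReal.ofReal_mul (by positivity), inv_mul_eq_div]
  calc ENNReal.ofReal (‖z.1‖ ^ μ / R) * ‖fderiv ℝ u z (z.1, (1 + μ) • z.2)‖ₑ
      ≤ ENNReal.ofReal (‖z.1‖ ^ μ / R) *
        (‖fderiv ℝ u z (z.1, 0)‖ₑ + ‖fderiv ℝ u z (0, (1 + μ) • z.2)‖ₑ) := by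
        rw [hsplit]; gcongr; exact enorm_add_le _ _
    _ = ENNReal.ofReal (‖z.1‖ ^ μ / R) * ‖fderiv ℝ u z (z.1, 0)‖ₑ +
        ENNReal.ofReal R⁻¹ * (‖z.1‖ₑ ^ μ * ‖fderiv ℝ u z (0, (1 + μ) • z.2)‖ₑ) := by
        rw [mul_add, ← mul_assoc (ENNReal.ofReal R⁻¹), ← hW]
    _ ≤ ENNReal.ofReal (‖z.1‖ ^ μ / R) * (‖z.1‖ₑ * g z) +
        ENNReal.ofReal R⁻¹ * (‖(1 + μ) • z.2‖ₑ * g z) := by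
        exact add_le_add (mul_le_mul_right (hg.fst z _) _) (mul_le_mul_right (hg.snd z _) _)
    _ ≤ 1 * g z + 1 * g z := by
        rw [← mul_assoc, ← mul_assoc]; gcongr
    _ = 2 * g z := by rw [one_mul, two_mul]

/-- Interpolation between the Hardy and the Sobolev integrals. -/
theorem lintegral_rpow_mul_rpow_le_interpolate {α : Type*} [MeasurableSpace α] {ν : Measure α}
    {W v : α → ℝ≥0∞} (hW : AEMeasurable W ν) (hv : AEMeasurable v ν) {p q s : ℝ} (hp : 0 < p)
    (hq : 0 ≤ q) (hs0 : 0 ≤ s) (hsp : s ≤ p) :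
    ∫⁻ a, W a ^ s * v a ^ (s + q * (1 - s / p)) ∂ν ≤
      (∫⁻ a, (W a * v a) ^ p ∂ν) ^ (s / p) * (∫⁻ a, v a ^ q ∂ν) ^ (1 - s / p) := by
  have h1 : 0 ≤ 1 - s / p := by rw [sub_nonneg, div_le_one hp]; exact hsp
  refine le_trans (le_of_eq (lintegral_congr fun a => ?_)) (ENNReal.lintegral_mul_norm_pow_le
    ((hW.mul hv).pow_const p) (hv.pow_const q) (by positivity) h1 (by ring))
  rw [← ENNReal.rpow_mul, ← ENNReal.rpow_mul, mul_div_cancel₀ s hp.ne', Pi.mul_apply,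
    ENNReal.mul_rpow_of_nonneg _ _ hs0, ENNReal.rpow_add_of_nonneg _ _ hs0 (by positivity),
    mul_assoc]

theorem enorm_hardy_sobolev_integrand {p s Q : ℝ} (hs0 : 0 ≤ s) (hμ : 0 ≤ μ)
    (hexp : 0 ≤ p * (Q - s) / (Q - p)) :
    ‖‖z.1‖ ^ (μ * s) / grho μ z ^ (μ * s) * (|u z| ^ (p * (Q - s) / (Q - p)) / grho μ z ^ s)‖ₑ =
      ENNReal.ofReal (‖z.1‖ ^ μ / grho μ z ^ (1 + μ)) ^ s *
        ‖u z‖ₑ ^ (p * (Q - s) / (Q - p)) := by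
  have hρ : 0 ≤ grho μ z := grho_nonneg
  rw [Real.enorm_eq_ofReal (by positivity), Real.enorm_eq_ofReal_abs,
    ENNReal.ofReal_rpow_of_nonneg (by positivity) hs0,
    ENNReal.ofReal_rpow_of_nonneg (by positivity) hexp, ← ENNReal.ofReal_mul (by positivity),
    Real.div_rpow (by positivity) (by positivity), ← Real.rpow_mul hρ,
    ← Real.rpow_mul (norm_nonneg _), add_mul, one_mul,
    Real.rpow_add_of_nonneg hρ hs0 (by positivity)]
  congr 1
  ring

end Grushin

/-- Hardy–Sobolev type inequality for the Grushin gradient. -/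
theorem hardy_sobolev_grushin
    (d k : ℕ) (hd : 1 ≤ d) (hk : 1 ≤ k) (μ : ℝ) (hμ : 0 < μ)
    (Q : ℝ) (hQ : Q = d + (1 + μ) * k)
    (p s : ℝ) (hp1 : 1 < p) (hpQ : p < Q) (hs0 : 0 ≤ s) (hsp : s ≤ p) :
    ∃ C : ℝ, 0 < C ∧
      ∀ u : EuclideanSpace ℝ (Fin d) × EuclideanSpace ℝ (Fin k) → ℝ,
        ContDiff ℝ (⊤ : ℕ∞) u → HasCompactSupport u →
        ∫ z, ‖z.1‖ ^ (μ * s) / grho μ z ^ (μ * s) *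
            (|u z| ^ (p * (Q - s) / (Q - p)) / grho μ z ^ s)
          ≤ C * (∫ z, gradMuNorm μ u z ^ p) ^ ((Q - s) / (Q - p)) := by
  have hp0 : 0 < p := by linarith
  have hQ0 : 0 < Q := by linarith
  have hQp : 0 < Q - p := by linarith
  have hQs : 0 ≤ Q - s := by linarith
  have hsp' : 0 ≤ 1 - s / p := by rw [sub_nonneg, div_le_one hp0]; exact hsp
  have hQ' : Q = Module.finrank ℝ (EuclideanSpace ℝ (Fin d)) +
      (1 + μ) * Module.finrank ℝ (EuclideanSpace ℝ (Fin k)) := by simpa using hQ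
  have : Nonempty (Fin d) := ⟨⟨0, hd⟩⟩
  obtain ⟨C₁, hC₁, hhardy⟩ := exists_grushin_hardy hp1 hQ' hpQ
  obtain ⟨C₂, hC₂, hsob⟩ := exists_grushin_sobolev hμ.le hp1.le hQ' hpQ
  set K : ℝ≥0∞ := (C₁ * 2 ^ p) ^ (s / p) * C₂ ^ (1 - s / p) with hK
  have hKtop : K ≠ ∞ := ENNReal.mul_ne_top
    (ENNReal.rpow_ne_top_of_nonneg (by positivity) (by finiteness))
    (ENNReal.rpow_ne_top_of_nonneg hsp' hC₂)
  refine ⟨K.toReal + 1, by positivity, fun u hu hsupp => ?_⟩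
  have hu1 : ContDiff ℝ 1 u := hu.of_le (by exact_mod_cast le_top)
  have hud := hu1.differentiable one_ne_zero
  have hcont := continuous_gradMuNorm hμ.le hu1
  have hbound := isGrushinBound_gradMuNorm hμ.le hud
  set g : EuclideanSpace ℝ (Fin d) × EuclideanSpace ℝ (Fin k) → ℝ≥0∞ :=
    fun z => ENNReal.ofReal (gradMuNorm μ u z) with hg
  set W : EuclideanSpace ℝ (Fin d) × EuclideanSpace ℝ (Fin k) → ℝ≥0∞ :=
    fun z => ENNReal.ofReal (‖z.1‖ ^ μ / grho μ z ^ (1 + μ)) with hW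
  have hgm : Measurable g := hcont.measurable.ennreal_ofReal
  have hWm : Measurable W := by
    have := measurable_grho (μ := μ) (d := d) (k := k)
    fun_prop
  have hD : ∫⁻ z, g z ^ p = ENNReal.ofReal (∫ z, gradMuNorm μ u z ^ p) := by
    rw [ofReal_integral_eq_lintegral_ofReal]
    · simp only [hg, ENNReal.ofReal_rpow_of_nonneg (gradMuNorm_nonneg _) hp0.le]
    · refine (hcont.rpow_const fun _ => Or.inr hp0.le).integrable_of_hasCompactSupport ?_
      exact (hsupp.gradMuNorm hud).comp_left (g := fun t : ℝ => t ^ p) (Real.zero_rpow hp0.ne')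
    · exact Filter.Eventually.of_forall fun z => Real.rpow_nonneg (gradMuNorm_nonneg _) _
  have hD0 : 0 ≤ ∫ z, gradMuNorm μ u z ^ p :=
    integral_nonneg fun z => Real.rpow_nonneg (gradMuNorm_nonneg _) _
  have h₁ : ∫⁻ z, (W z * ‖u z‖ₑ) ^ p ≤ C₁ * 2 ^ p * ∫⁻ z, g z ^ p := by
    refine (hhardy u (fun z => 2 * g z) W hu1 hsupp (hgm.const_mul 2) (fun z hz => ?_)
      (fun t z ht => ofReal_norm_fst_div_grho_grushinDilation hμ.le ht)
      (hbound.norm_fst_div_grho_mul_enorm_fderiv_le hμ.le)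
      fun z => ENNReal.ofReal_ne_top).trans (le_of_eq ?_)
    · simp [hW, hz, hμ.ne']
    · simp_rw [ENNReal.mul_rpow_of_nonneg _ _ hp0.le]
      rw [lintegral_const_mul' _ _ (by finiteness), mul_assoc]
  have h₂ := hsob u g hu1 hsupp hbound
  have hexp : p * (Q - s) / (Q - p) = s + p * Q / (Q - p) * (1 - s / p) := by
    field_simp; ring
  have hexp' : (Q - s) / (Q - p) = s / p + Q / (Q - p) * (1 - s / p) := by
    field_simp; ring
  have hmain : ∫⁻ z, ‖‖z.1‖ ^ (μ * s) / grho μ z ^ (μ * s) *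
      (|u z| ^ (p * (Q - s) / (Q - p)) / grho μ z ^ s)‖ₑ ≤
        K * (∫⁻ z, g z ^ p) ^ ((Q - s) / (Q - p)) := by
    simp_rw [enorm_hardy_sobolev_integrand hs0 hμ.le (by positivity : 0 ≤ p * (Q - s) / (Q - p))]
    rw [hexp]
    refine (lintegral_rpow_mul_rpow_le_interpolate hWm.aemeasurable
      hu.continuous.enorm.measurable.aemeasurable hp0 (by positivity) hs0 hsp).trans ?_
    grw [h₁, h₂]
    rw [ENNReal.mul_rpow_of_nonneg _ _ (by positivity), ENNReal.mul_rpow_of_nonneg _ _ hsp',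
      ← ENNReal.rpow_mul, mul_mul_mul_comm, hexp',
      ENNReal.rpow_add_of_nonneg _ _ (by positivity) (by positivity)]
  refine (le_abs_self _).trans ?_
  rw [← ENNReal.ofReal_le_ofReal_iff (by positivity), ← Real.enorm_eq_ofReal_abs]
  refine (enorm_integral_le_lintegral_enorm _).trans (hmain.trans ?_)
  rw [hD, ENNReal.ofReal_rpow_of_nonneg hD0 (by positivity), ENNReal.ofReal_mul (by positivity)]
  gcongr
  rw [← ENNReal.ofReal_toReal hKtop]
  exact ENNReal.ofReal_le_ofReal (by simp)
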